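/- For α ∈ (1,2) and n = 4, a strategy profile s is a strong equilibrium of the network creation game if and only if s is rational, G(s) is the 4-cycle, and every player buys exactly one edge (|s_i| = 1 and f(s,i) = 1 for all i). -/

import Mathlib

open SimpleGraph ENNReal Finset

/-- A strategy profile: each player chooses a set of other players. -/
abbrev Profile (n : ℕ) := Fin n → Finset (Fin n)

/-- Validity: no player buys an edge to herself. -/
def Valid {n : ℕ} (s : Profile n) : Prop := ∀ i, i ∉ s i

/-- The graph formed by a strategy profile: `{i,j}` is an edge iff `j ∈ s i` or `i ∈ s j`. -/
def NCGraph {n : ℕ} (s : Profile n) : SimpleGraph (Fin n) :=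
  SimpleGraph.fromRel (fun i j => j ∈ s i)

instance {n : ℕ} (s : Profile n) : DecidableRel (NCGraph s).Adj := fun i j =>
  decidable_of_iff (i ≠ j ∧ (j ∈ s i ∨ i ∈ s j))
    (SimpleGraph.fromRel_adj (fun a b => b ∈ s a) i j).symm

/-- Distance cost of player `i`: sum of (extended) distances to all players. -/
noncomputable def dCost {n : ℕ} (s : Profile n) (i : Fin n) : ℝ≥0∞ :=
  ∑ j, ((NCGraph s).edist i j : ℝ≥0∞)

/-- Total cost of player `i` in the network creation game with parameter `α`. -/
noncomputable def cost {n : ℕ} (α : ℝ) (s : Profile n) (i : Fin n) : ℝ≥0∞ :=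
  ENNReal.ofReal α * (s i).card + dCost s i

/-- Social cost: sum of all players' costs. -/
noncomputable def socialCost {n : ℕ} (α : ℝ) (s : Profile n) : ℝ≥0∞ :=
  ∑ i, cost α s i

/-- A profile is rational if no edge is bought by both of its endpoints. -/
def Rational {n : ℕ} (s : Profile n) : Prop := ∀ i j, j ∈ s i → i ∉ s j

/-- Pure Nash equilibrium. -/
def IsNashEq {n : ℕ} (α : ℝ) (s : Profile n) : Prop :=
  ∀ (i : Fin n) (t : Finset (Fin n)), i ∉ t →
    cost α s i ≤ cost α (Function.update s i t) i

/-- Strong equilibrium: no nonempty coalition has a joint deviation strictly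
decreasing every member's cost. -/
def IsStrongEq {n : ℕ} (α : ℝ) (s : Profile n) : Prop :=
  ∀ (K : Finset (Fin n)) (s' : Profile n), K.Nonempty → Valid s' →
    (∀ i ∉ K, s' i = s i) → ∃ i ∈ K, cost α s i ≤ cost α s' i

/-- A star graph: one center adjacent to all other vertices, and no other edges. -/
def IsStar {V : Type*} (G : SimpleGraph V) : Prop :=
  ∃ c : V, ∀ i j : V, G.Adj i j ↔ i ≠ j ∧ (i = c ∨ j = c)

/-! ### Distances in graphs on four vertices -/

/-- Distance from `i` to `j` in a graph on `{i,j,k,l}`, `99` standing for infinity. The Booleans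
are the adjacencies `ij`, `ik`, `il`, `jk`, `jl`, `kl`. -/
def dd (p q r x y z : Bool) : ℕ :=
  bif p then 1 else bif (q && x) || (r && y) then 2 else
  bif (q && (z && y)) || (r && (z && x)) then 3 else 99

/-- Sum of the distances from `i`. -/
def ds (p q r x y z : Bool) : ℕ := dd p q r x y z + (dd q p r x z y + dd r p q y z x)

/-- Decode a number as an extended one. -/
noncomputable def TT (n : ℕ) : ℕ∞ := if 99 ≤ n then ⊤ else n

lemma short_walk (G : SimpleGraph (Fin 4)) {i j : Fin 4} (hij : i ≠ j) (w : G.Walk i j)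
    (hw : w.length ≤ 3) (h1 : ¬ G.Adj i j) :
    (∃ u, G.Adj i u ∧ G.Adj u j) ∨
      (w.length = 3 ∧ ∃ u v, G.Adj i u ∧ G.Adj u v ∧ G.Adj v j) := by
  cases w with
  | nil => exact absurd rfl hij
  | cons ha w =>
    cases w with
    | nil => exact absurd ha h1
    | cons hb w =>
      cases w with
      | nil => exact Or.inl ⟨_, ha, hb⟩
      | cons hc w =>
        cases w with
        | nil => exact Or.inr ⟨rfl, _, _, ha, hb, hc⟩
        | cons hd w => simp at hw; omega

lemma edist_dd (G : SimpleGraph (Fin 4)) [DecidableRel G.Adj] (i j k l : Fin 4)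
    (hij : i ≠ j) (h4 : ∀ x, x = i ∨ x = j ∨ x = k ∨ x = l) :
    G.edist i j = TT (dd (decide (G.Adj i j)) (decide (G.Adj i k)) (decide (G.Adj i l))
      (decide (G.Adj j k)) (decide (G.Adj j l)) (decide (G.Adj k l))) := by
  by_cases h1 : G.Adj i j
  · simp [dd, h1, TT, edist_eq_one_iff_adj]
  have key : ∀ w : G.Walk i j, w.length ≤ 3 →
      ((G.Adj i k ∧ G.Adj j k) ∨ (G.Adj i l ∧ G.Adj j l)) ∨
      (w.length = 3 ∧ ((G.Adj i k ∧ G.Adj k l ∧ G.Adj j l) ∨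
        (G.Adj i l ∧ G.Adj k l ∧ G.Adj j k))) := by
    intro w hw
    rcases short_walk G hij w hw h1 with ⟨u, hu, hu'⟩ | ⟨h3, u, v, hu, huv, hv⟩
    · rcases h4 u with rfl | rfl | rfl | rfl
      · exact absurd hu (G.irrefl)
      · exact absurd hu h1
      · exact Or.inl (Or.inl ⟨hu, hu'.symm⟩)
      · exact Or.inl (Or.inr ⟨hu, hu'.symm⟩)
    · rcases h4 u with rfl | rfl | rfl | rfl
      · exact absurd hu (G.irrefl)
      · exact absurd hu h1
      · rcases h4 v with rfl | rfl | rfl | rfl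
        · exact absurd hv h1
        · exact absurd hv (G.irrefl)
        · exact absurd huv (G.irrefl)
        · exact Or.inr ⟨h3, Or.inl ⟨hu, huv, hv.symm⟩⟩
      · rcases h4 v with rfl | rfl | rfl | rfl
        · exact absurd hv h1
        · exact absurd hv (G.irrefl)
        · exact Or.inr ⟨h3, Or.inr ⟨hu, huv.symm, hv.symm⟩⟩
        · exact absurd huv (G.irrefl)
  by_cases h2 : (G.Adj i k ∧ G.Adj j k) ∨ (G.Adj i l ∧ G.Adj j l)
  · have hd : dd (decide (G.Adj i j)) (decide (G.Adj i k)) (decide (G.Adj i l))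
      (decide (G.Adj j k)) (decide (G.Adj j l)) (decide (G.Adj k l)) = 2 := by
      rcases h2 with ⟨a, b⟩ | ⟨a, b⟩ <;> simp [dd, h1, a, b]
    rw [hd]
    have hT : TT 2 = 2 := by simp [TT]
    rw [hT]
    apply le_antisymm
    · rcases h2 with ⟨a, b⟩ | ⟨a, b⟩
      · exact edist_le (Walk.cons a (Walk.cons b.symm Walk.nil))
      · exact edist_le (Walk.cons a (Walk.cons b.symm Walk.nil))
    · by_contra hlt
      push Not at hlt
      obtain ⟨w, hw⟩ := exists_walk_of_edist_ne_top (ne_top_of_lt hlt)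
      rw [← hw] at hlt
      have hl : w.length < 2 := by exact_mod_cast hlt
      cases w with
      | nil => exact absurd rfl hij
      | cons ha w =>
        cases w with
        | nil => exact absurd ha h1
        | cons hb w => simp at hl
  have h2' : ((decide (G.Adj i k) && decide (G.Adj j k)) ||
      (decide (G.Adj i l) && decide (G.Adj j l))) = false := by
    rw [← Bool.not_eq_true]
    simpa only [Bool.or_eq_true, Bool.and_eq_true, decide_eq_true_eq] using h2
  by_cases h3 : (G.Adj i k ∧ G.Adj k l ∧ G.Adj j l) ∨ (G.Adj i l ∧ G.Adj k l ∧ G.Adj j k)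
  · have hd : dd (decide (G.Adj i j)) (decide (G.Adj i k)) (decide (G.Adj i l))
      (decide (G.Adj j k)) (decide (G.Adj j l)) (decide (G.Adj k l)) = 3 := by
      unfold dd
      rw [h2']
      rcases h3 with ⟨a, b, c⟩ | ⟨a, b, c⟩ <;> simp [h1, a, b, c]
    rw [hd]
    have hT : TT 3 = 3 := by simp [TT]
    rw [hT]
    apply le_antisymm
    · rcases h3 with ⟨a, b, c⟩ | ⟨a, b, c⟩
      · exact edist_le (Walk.cons a (Walk.cons b (Walk.cons c.symm Walk.nil)))
      · exact edist_le (Walk.cons a (Walk.cons b.symm (Walk.cons c.symm Walk.nil)))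
    · by_contra hlt
      push Not at hlt
      obtain ⟨w, hw⟩ := exists_walk_of_edist_ne_top (ne_top_of_lt hlt)
      rw [← hw] at hlt
      have hl : w.length < 3 := by exact_mod_cast hlt
      rcases key w hl.le with h | ⟨h, -⟩
      · exact h2 h
      · omega
  · have hd : dd (decide (G.Adj i j)) (decide (G.Adj i k)) (decide (G.Adj i l))
      (decide (G.Adj j k)) (decide (G.Adj j l)) (decide (G.Adj k l)) = 99 := by
      have h3' : ((decide (G.Adj i k) && (decide (G.Adj k l) && decide (G.Adj j l))) ||
          (decide (G.Adj i l) && (decide (G.Adj k l) && decide (G.Adj j k)))) = false := by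
        rw [← Bool.not_eq_true]
        simpa only [Bool.or_eq_true, Bool.and_eq_true, decide_eq_true_eq] using h3
      unfold dd
      rw [h2', h3']
      simp [h1]
    rw [hd]
    have hT : TT 99 = ⊤ := by simp [TT]
    rw [hT]
    by_contra hne
    obtain ⟨w, hw⟩ := exists_walk_of_edist_ne_top hne
    have hp := (w.toPath.2).length_lt
    simp only [Fintype.card_fin] at hp
    rcases key w.toPath.1 (by omega) with h | ⟨-, h⟩
    · exact h2 h
    · exact h3 h

lemma dd_bound (p q r x y z : Bool) : dd p q r x y z ≤ 3 ∨ dd p q r x y z = 99 := by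
  revert p q r x y z; decide

lemma TT_add3 {a b c : ℕ} (ha : a ≤ 3 ∨ a = 99) (hb : b ≤ 3 ∨ b = 99) (hc : c ≤ 3 ∨ c = 99) :
    TT a + (TT b + TT c) = TT (a + (b + c)) := by
  unfold TT
  rcases ha with ha | ha
  · rcases hb with hb | hb
    · rcases hc with hc | hc
      · rw [if_neg (by omega), if_neg (by omega), if_neg (by omega), if_neg (by omega)]
        push_cast; rfl
      · rw [if_pos (c := 99 ≤ c) (by omega), if_pos (c := 99 ≤ a + (b + c)) (by omega)]
        simp
    · rw [if_pos (c := 99 ≤ b) (by omega), if_pos (c := 99 ≤ a + (b + c)) (by omega)]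
      simp
  · rw [if_pos (c := 99 ≤ a) (by omega), if_pos (c := 99 ≤ a + (b + c)) (by omega)]
    simp

/-! ### Encoding strategies as bit masks -/

/-- Decode a mask. -/
def dec (m : ℕ) : Finset (Fin 4) := Finset.univ.filter (fun j => m.testBit j.val = true)

/-- Decode four masks. -/
def PP (a b c d : ℕ) : Profile 4 := ![dec a, dec b, dec c, dec d]

/-- Is the edge between `i` (with mask `m`) and `j` (with mask `n`) present? -/
def eb (m n i j : ℕ) : Bool := m.testBit j || n.testBit i

/-- Number of edges bought. -/
def pc (m : ℕ) : ℕ :=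
  (m.testBit 0).toNat + (m.testBit 1).toNat + (m.testBit 2).toNat + (m.testBit 3).toNat

def d0 (a b c d : ℕ) : ℕ := ds (eb a b 0 1) (eb a c 0 2) (eb a d 0 3)
  (eb b c 1 2) (eb b d 1 3) (eb c d 2 3)
def d1 (a b c d : ℕ) : ℕ := ds (eb a b 0 1) (eb b c 1 2) (eb b d 1 3)
  (eb a c 0 2) (eb a d 0 3) (eb c d 2 3)
def d2 (a b c d : ℕ) : ℕ := ds (eb a c 0 2) (eb b c 1 2) (eb c d 2 3)
  (eb a b 0 1) (eb a d 0 3) (eb b d 1 3)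
def d3 (a b c d : ℕ) : ℕ := ds (eb a d 0 3) (eb b d 1 3) (eb c d 2 3)
  (eb a b 0 1) (eb a c 0 2) (eb b c 1 2)

lemma mem_dec (m : ℕ) (j : Fin 4) : j ∈ dec m ↔ m.testBit j.val = true := by simp [dec]

lemma card_dec (m : ℕ) : (dec m).card = pc m := by
  rw [dec, Finset.card_filter, Fin.sum_univ_four]
  simp only [pc, Bool.toNat, Bool.cond_eq_ite]
  rfl

lemma adj_PP (s : Profile 4) (i j : Fin 4) (m n : ℕ) (hm : s i = dec m) (hn : s j = dec n)
    (hij : i ≠ j) : decide ((NCGraph s).Adj i j) = eb m n i.val j.val := by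
  rw [Bool.eq_iff_iff]
  simp [NCGraph, SimpleGraph.fromRel_adj, hij, hm, hn, mem_dec, eb]

lemma dCost_eq (s : Profile 4) (i j k l : Fin 4)
    (hij : i ≠ j) (hik : i ≠ k) (hil : i ≠ l) (hjk : j ≠ k) (hjl : j ≠ l) (hkl : k ≠ l)
    (h4 : ∀ x, x = i ∨ x = j ∨ x = k ∨ x = l) :
    dCost s i = ((TT (ds (decide ((NCGraph s).Adj i j)) (decide ((NCGraph s).Adj i k))
      (decide ((NCGraph s).Adj i l)) (decide ((NCGraph s).Adj j k))
      (decide ((NCGraph s).Adj j l)) (decide ((NCGraph s).Adj k l))) : ℕ∞) : ℝ≥0∞) := by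
  have hu : (Finset.univ : Finset (Fin 4)) = {i, j, k, l} := by
    ext x; simpa using h4 x
  have e1 := edist_dd (NCGraph s) i j k l hij h4
  have e2 := edist_dd (NCGraph s) i k j l hik (fun x => by have := h4 x; tauto)
  have e3 := edist_dd (NCGraph s) i l j k hil (fun x => by have := h4 x; tauto)
  have c1 := SimpleGraph.adj_comm (NCGraph s) k j
  have c2 := SimpleGraph.adj_comm (NCGraph s) l j
  have c3 := SimpleGraph.adj_comm (NCGraph s) l k
  simp only [c1, c2, c3] at e1 e2 e3
  unfold dCost
  rw [hu, Finset.sum_insert (by simp [*]), Finset.sum_insert (by simp [*]),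
    Finset.sum_insert (by simp [*]), Finset.sum_singleton, e1, e2, e3, ds,
    ← TT_add3 (dd_bound _ _ _ _ _ _) (dd_bound _ _ _ _ _ _) (dd_bound _ _ _ _ _ _)]
  simp

/-- Value of the cost with `c` edges and distance sum `d`. -/
noncomputable def cv (α : ℝ) (c d : ℕ) : ℝ≥0∞ := ENNReal.ofReal α * c + ((TT d : ℕ∞) : ℝ≥0∞)

section costs
variable (α : ℝ) (a b c d : ℕ)

lemma cost0 : cost α (PP a b c d) 0 = cv α (pc a) (d0 a b c d) := by
  rw [cost, dCost_eq _ 0 1 2 3 (by decide) (by decide) (by decide) (by decide) (by decide)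
    (by decide) (by decide), cv, d0, ← card_dec]
  rw [adj_PP _ 0 1 a b rfl rfl (by decide), adj_PP _ 0 2 a c rfl rfl (by decide),
    adj_PP _ 0 3 a d rfl rfl (by decide), adj_PP _ 1 2 b c rfl rfl (by decide),
    adj_PP _ 1 3 b d rfl rfl (by decide), adj_PP _ 2 3 c d rfl rfl (by decide)]
  rfl

lemma cost1 : cost α (PP a b c d) 1 = cv α (pc b) (d1 a b c d) := by
  rw [cost, dCost_eq _ 1 0 2 3 (by decide) (by decide) (by decide) (by decide) (by decide)
    (by decide) (by decide), cv, d1, ← card_dec]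
  simp only [SimpleGraph.adj_comm _ (1 : Fin 4) 0]
  rw [adj_PP _ 0 1 a b rfl rfl (by decide), adj_PP _ 0 2 a c rfl rfl (by decide),
    adj_PP _ 0 3 a d rfl rfl (by decide), adj_PP _ 1 2 b c rfl rfl (by decide),
    adj_PP _ 1 3 b d rfl rfl (by decide), adj_PP _ 2 3 c d rfl rfl (by decide)]
  rfl

lemma cost2 : cost α (PP a b c d) 2 = cv α (pc c) (d2 a b c d) := by
  rw [cost, dCost_eq _ 2 0 1 3 (by decide) (by decide) (by decide) (by decide) (by decide)
    (by decide) (by decide), cv, d2, ← card_dec]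
  simp only [SimpleGraph.adj_comm _ (2 : Fin 4) 0, SimpleGraph.adj_comm _ (2 : Fin 4) 1]
  rw [adj_PP _ 0 1 a b rfl rfl (by decide), adj_PP _ 0 2 a c rfl rfl (by decide),
    adj_PP _ 0 3 a d rfl rfl (by decide), adj_PP _ 1 2 b c rfl rfl (by decide),
    adj_PP _ 1 3 b d rfl rfl (by decide), adj_PP _ 2 3 c d rfl rfl (by decide)]
  rfl

lemma cost3 : cost α (PP a b c d) 3 = cv α (pc d) (d3 a b c d) := by
  rw [cost, dCost_eq _ 3 0 1 2 (by decide) (by decide) (by decide) (by decide) (by decide)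
    (by decide) (by decide), cv, d3, ← card_dec]
  simp only [SimpleGraph.adj_comm _ (3 : Fin 4) 0, SimpleGraph.adj_comm _ (3 : Fin 4) 1,
    SimpleGraph.adj_comm _ (3 : Fin 4) 2]
  rw [adj_PP _ 0 1 a b rfl rfl (by decide), adj_PP _ 0 2 a c rfl rfl (by decide),
    adj_PP _ 0 3 a d rfl rfl (by decide), adj_PP _ 1 2 b c rfl rfl (by decide),
    adj_PP _ 1 3 b d rfl rfl (by decide), adj_PP _ 2 3 c d rfl rfl (by decide)]
  rfl

end costs

/-! ### Comparing costs uniformly in `α ∈ (1,2)` -/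

lemma cv_fin (α : ℝ) (h : 0 ≤ α) (c d : ℕ) (hd : d < 99) :
    cv α c d = ENNReal.ofReal (α * c + d) := by
  rw [cv, TT, if_neg (by omega), ENNReal.ofReal_add (by positivity) (by positivity),
    ENNReal.ofReal_mul h]
  simp

lemma cv_top (α : ℝ) (c d : ℕ) (hd : 99 ≤ d) : cv α c d = ⊤ := by
  rw [cv, TT, if_pos hd]; simp

/-- The second pair is strictly cheaper than `(c,d)` for all `α ∈ (1,2)`. -/
def imp (c d c' d' : ℕ) : Bool :=
  Nat.ble d' 98 && (Nat.ble 99 d || (Nat.ble (c' + d') (c + d) &&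
    (Nat.ble (2 * c' + d') (2 * c + d) && !(Nat.beq c c' && Nat.beq d d'))))

lemma imp_lt {α : ℝ} (h1 : 1 < α) (h2 : α < 2) {c d c' d' : ℕ} (h : imp c d c' d' = true) :
    cv α c' d' < cv α c d := by
  simp only [imp, Bool.and_eq_true, Bool.or_eq_true, Nat.ble_eq, Bool.not_eq_true',
    Bool.and_eq_false_iff] at h
  obtain ⟨hd', h⟩ := h
  rw [cv_fin α (by linarith) c' d' (by omega)]
  by_cases hd : 99 ≤ d
  · rw [cv_top α c d hd]; exact ENNReal.ofReal_lt_top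
  obtain ⟨ha, hb, hc⟩ := h.resolve_left hd
  have hne : c + d ≠ c' + d' ∨ 2 * c + d ≠ 2 * c' + d' := by
    rcases hc with hc | hc
    · have := Nat.ne_of_beq_eq_false hc; omega
    · have := Nat.ne_of_beq_eq_false hc; omega
  rw [cv_fin α (by linarith) c d (by omega)]
  have ha' : (c' : ℝ) + d' ≤ c + d := by exact_mod_cast ha
  have hb' : 2 * (c' : ℝ) + d' ≤ 2 * c + d := by exact_mod_cast hb
  have hs : α * c' + d' < α * c + d := by
    rcases hne with hne | hne
    · have ha2 : (c' : ℝ) + d' < c + d := by exact_mod_cast (by omega : c' + d' < c + d)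
      nlinarith
    · have hb2 : 2 * (c' : ℝ) + d' < 2 * c + d := by
        exact_mod_cast (by omega : 2 * c' + d' < 2 * c + d)
      nlinarith
  have : 0 ≤ α * c' + d' := by positivity
  exact (ENNReal.ofReal_lt_ofReal_iff (by linarith)).2 hs

/-- The pair is not cheaper than `(1,4)`. -/
def nb (c' d' : ℕ) : Bool := Nat.ble 5 (c' + d') && Nat.ble 6 (2 * c' + d')

lemma nb_le {α : ℝ} (h1 : 1 < α) (h2 : α < 2) {c' d' : ℕ} (h : nb c' d' = true) :
    cv α 1 4 ≤ cv α c' d' := by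
  simp only [nb, Bool.and_eq_true, Nat.ble_eq] at h
  by_cases hd : 99 ≤ d'
  · rw [cv_top α c' d' hd]; exact le_top
  rw [cv_fin α (by linarith) _ _ (by omega), cv_fin α (by linarith) _ _ (by omega)]
  apply ENNReal.ofReal_le_ofReal
  have ha : (5 : ℝ) ≤ c' + d' := by exact_mod_cast h.1
  have hb : (6 : ℝ) ≤ 2 * c' + d' := by exact_mod_cast h.2
  push_cast
  nlinarith

/-! ### Exhaustive search -/

def M0 : List ℕ := [0, 2, 4, 6, 8, 10, 12, 14]
def M1 : List ℕ := [0, 1, 4, 5, 8, 9, 12, 13]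
def M2 : List ℕ := [0, 1, 2, 3, 8, 9, 10, 11]
def M3 : List ℕ := [0, 1, 2, 3, 4, 5, 6, 7]

lemma exists_mask0 : ∀ t : Finset (Fin 4), 0 ∉ t → ∃ m ∈ M0, t = dec m := by decide +kernel
lemma exists_mask1 : ∀ t : Finset (Fin 4), 1 ∉ t → ∃ m ∈ M1, t = dec m := by decide +kernel
lemma exists_mask2 : ∀ t : Finset (Fin 4), 2 ∉ t → ∃ m ∈ M2, t = dec m := by decide +kernel
lemma exists_mask3 : ∀ t : Finset (Fin 4), 3 ∉ t → ∃ m ∈ M3, t = dec m := by decide +kernel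

lemma exists_masks (s : Profile 4) (hv : Valid s) :
    ∃ a ∈ M0, ∃ b ∈ M1, ∃ c ∈ M2, ∃ d ∈ M3, s = PP a b c d := by
  obtain ⟨a, ha, ea⟩ := exists_mask0 _ (hv 0)
  obtain ⟨b, hb, eb⟩ := exists_mask1 _ (hv 1)
  obtain ⟨c, hc, ec⟩ := exists_mask2 _ (hv 2)
  obtain ⟨d, hd, ed⟩ := exists_mask3 _ (hv 3)
  refine ⟨a, ha, b, hb, c, hc, d, hd, ?_⟩
  funext i
  fin_cases i
  · exact ea
  · exact eb
  · exact ec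
  · exact ed

/-- A valid deviation strictly improving all players who change. -/
def isDev (a b c d a' b' c' d' : ℕ) : Bool :=
  ((Nat.beq a a' || imp (pc a) (d0 a b c d) (pc a') (d0 a' b' c' d')) &&
  ((Nat.beq b b' || imp (pc b) (d1 a b c d) (pc b') (d1 a' b' c' d')) &&
  ((Nat.beq c c' || imp (pc c) (d2 a b c d) (pc c') (d2 a' b' c' d')) &&
  (Nat.beq d d' || imp (pc d) (d3 a b c d) (pc d') (d3 a' b' c' d'))))) &&
  (!(Nat.beq a a' && (Nat.beq b b' && (Nat.beq c c' && Nat.beq d d'))) &&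
  (!(a'.testBit 0) && (!(b'.testBit 1) && (!(c'.testBit 2) && !(d'.testBit 3)))))

lemma not_strong_of_isDev {α : ℝ} (h1 : 1 < α) (h2 : α < 2) {a b c d a' b' c' d' : ℕ}
    (h : isDev a b c d a' b' c' d' = true) : ¬ IsStrongEq α (PP a b c d) := by
  simp only [isDev, Bool.and_eq_true, Bool.or_eq_true, Nat.beq_eq, Bool.not_eq_true'] at h
  obtain ⟨⟨i0, i1, i2, i3⟩, hne, v0, v1, v2, v3⟩ := h
  have hne' : ¬ (a = a' ∧ b = b' ∧ c = c' ∧ d = d') := by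
    rintro ⟨rfl, rfl, rfl, rfl⟩
    simp at hne
  intro hS
  obtain ⟨i, hi, hle⟩ := hS
    (Finset.univ.filter (fun i => (![a, b, c, d] : Fin 4 → ℕ) i ≠ (![a', b', c', d'] : Fin 4 → ℕ) i))
    (PP a' b' c' d') (by
      by_contra hemp
      rw [Finset.not_nonempty_iff_eq_empty, Finset.filter_eq_empty_iff] at hemp
      apply hne'
      have q0 := hemp (Finset.mem_univ 0)
      have q1 := hemp (Finset.mem_univ 1)
      have q2 := hemp (Finset.mem_univ 2)
      have q3 := hemp (Finset.mem_univ 3)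
      exact ⟨not_not.1 q0, not_not.1 q1, not_not.1 q2, not_not.1 q3⟩)
    (by
      intro i
      fin_cases i
      · show ¬ (0 ∈ dec a')
        simp [mem_dec, v0]
      · show ¬ (1 ∈ dec b')
        simp [mem_dec, v1]
      · show ¬ (2 ∈ dec c')
        simp [mem_dec, v2]
      · show ¬ (3 ∈ dec d')
        simp [mem_dec, v3])
    (by
      intro i hi
      simp only [Finset.mem_filter, Finset.mem_univ, true_and, not_not] at hi
      fin_cases i
      · exact congrArg dec hi.symm
      · exact congrArg dec hi.symm
      · exact congrArg dec hi.symm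
      · exact congrArg dec hi.symm)
  simp only [Finset.mem_filter, Finset.mem_univ, true_and] at hi
  apply absurd hle
  rw [not_le]
  fin_cases i
  · show cost α (PP a' b' c' d') 0 < cost α (PP a b c d) 0
    rw [cost0, cost0]
    exact imp_lt h1 h2 (i0.resolve_left hi)
  · show cost α (PP a' b' c' d') 1 < cost α (PP a b c d) 1
    rw [cost1, cost1]
    exact imp_lt h1 h2 (i1.resolve_left hi)
  · show cost α (PP a' b' c' d') 2 < cost α (PP a b c d) 2
    rw [cost2, cost2]
    exact imp_lt h1 h2 (i2.resolve_left hi)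
  · show cost α (PP a' b' c' d') 3 < cost α (PP a b c d) 3
    rw [cost3, cost3]
    exact imp_lt h1 h2 (i3.resolve_left hi)

/-- The six good profiles. -/
def good (a b c d : ℕ) : Bool :=
  (Nat.beq a 2 && (Nat.beq b 4 && (Nat.beq c 8 && Nat.beq d 1))) ||
  ((Nat.beq a 2 && (Nat.beq b 8 && (Nat.beq c 1 && Nat.beq d 4))) ||
  ((Nat.beq a 4 && (Nat.beq b 1 && (Nat.beq c 8 && Nat.beq d 2))) ||
  ((Nat.beq a 4 && (Nat.beq b 8 && (Nat.beq c 2 && Nat.beq d 1))) ||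
  ((Nat.beq a 8 && (Nat.beq b 1 && (Nat.beq c 2 && Nat.beq d 4))) ||
  (Nat.beq a 8 && (Nat.beq b 4 && (Nat.beq c 1 && Nat.beq d 2)))))))

lemma good_cases {a b c d : ℕ} (h : good a b c d = true) :
    (a = 2 ∧ b = 4 ∧ c = 8 ∧ d = 1) ∨ (a = 2 ∧ b = 8 ∧ c = 1 ∧ d = 4) ∨
    (a = 4 ∧ b = 1 ∧ c = 8 ∧ d = 2) ∨ (a = 4 ∧ b = 8 ∧ c = 2 ∧ d = 1) ∨
    (a = 8 ∧ b = 1 ∧ c = 2 ∧ d = 4) ∨ (a = 8 ∧ b = 4 ∧ c = 1 ∧ d = 2) := by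
  simpa only [good, Bool.and_eq_true, Bool.or_eq_true, Nat.beq_eq] using h

/-- Is there an improving deviation among single-player ones and eight three-player ones? -/
def hasDev (a b c d : ℕ) : Bool :=
  M0.any (fun x => isDev a b c d x b c d) || (M1.any (fun x => isDev a b c d a x c d) ||
  (M2.any (fun x => isDev a b c d a b x d) || (M3.any (fun x => isDev a b c d a b c x) ||
  (isDev a b c d 2 4 1 d || (isDev a b c d 2 4 9 d || (isDev a b c d 2 8 c 1 ||
  (isDev a b c d 2 8 c 5 || (isDev a b c d 4 b 8 1 || (isDev a b c d 4 b 8 3 ||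
  (isDev a b c d a 4 8 2 || isDev a b c d a 4 8 3))))))))))

lemma hasDev_spec {a b c d : ℕ} (h : hasDev a b c d = true) :
    ∃ a' b' c' d', isDev a b c d a' b' c' d' = true := by
  simp only [hasDev, Bool.or_eq_true, List.any_eq_true] at h
  rcases h with ⟨x, -, h⟩ | ⟨x, -, h⟩ | ⟨x, -, h⟩ | ⟨x, -, h⟩ | h | h | h | h | h | h | h | h <;>
    exact ⟨_, _, _, _, h⟩

lemma search1 : (M0.all fun a => M1.all fun b => M2.all fun c => M3.all fun d =>
    good a b c d || hasDev a b c d) = true := by decide +kernel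

/-- Some player who changes does not get below the cost `(1,4)`. -/
def stable (a b c d a' b' c' d' : ℕ) : Bool :=
  (Nat.beq a a' && (Nat.beq b b' && (Nat.beq c c' && Nat.beq d d'))) ||
  ((!(Nat.beq a a') && nb (pc a') (d0 a' b' c' d')) ||
  ((!(Nat.beq b b') && nb (pc b') (d1 a' b' c' d')) ||
  ((!(Nat.beq c c') && nb (pc c') (d2 a' b' c' d')) ||
  (!(Nat.beq d d') && nb (pc d') (d3 a' b' c' d')))))

lemma search2 : (M0.all fun a' => M1.all fun b' => M2.all fun c' => M3.all fun d' =>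
    stable 2 4 8 1 a' b' c' d' && (stable 2 8 1 4 a' b' c' d' && (stable 4 1 8 2 a' b' c' d' &&
    (stable 4 8 2 1 a' b' c' d' && (stable 8 1 2 4 a' b' c' d' &&
      stable 8 4 1 2 a' b' c' d'))))) = true := by decide +kernel

lemma stable_of_good {a b c d a' b' c' d' : ℕ} (h : good a b c d = true)
    (ha : a' ∈ M0) (hb : b' ∈ M1) (hc : c' ∈ M2) (hd : d' ∈ M3) :
    stable a b c d a' b' c' d' = true := by
  have hs := search2
  simp only [List.all_eq_true] at hs
  have := hs a' ha b' hb c' hc d' hd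
  simp only [Bool.and_eq_true] at this
  obtain ⟨s1, s2, s3, s4, s5, s6⟩ := this
  rcases good_cases h with ⟨rfl, rfl, rfl, rfl⟩ | ⟨rfl, rfl, rfl, rfl⟩ | ⟨rfl, rfl, rfl, rfl⟩ |
    ⟨rfl, rfl, rfl, rfl⟩ | ⟨rfl, rfl, rfl, rfl⟩ | ⟨rfl, rfl, rfl, rfl⟩ <;> assumption

lemma good_vals {a b c d : ℕ} (h : good a b c d = true) :
    (pc a = 1 ∧ pc b = 1 ∧ pc c = 1 ∧ pc d = 1) ∧ (d0 a b c d = 4 ∧ d1 a b c d = 4 ∧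
      d2 a b c d = 4 ∧ d3 a b c d = 4) := by
  rcases good_cases h with ⟨rfl, rfl, rfl, rfl⟩ | ⟨rfl, rfl, rfl, rfl⟩ | ⟨rfl, rfl, rfl, rfl⟩ |
    ⟨rfl, rfl, rfl, rfl⟩ | ⟨rfl, rfl, rfl, rfl⟩ | ⟨rfl, rfl, rfl, rfl⟩ <;> decide +kernel

lemma strong_of_good {α : ℝ} (h1 : 1 < α) (h2 : α < 2) {a b c d : ℕ} (h : good a b c d = true)
    (hda : ∀ m, a ≠ m → m ∈ M0 → dec m ≠ dec a) (hdb : ∀ m, b ≠ m → m ∈ M1 → dec m ≠ dec b)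
    (hdc : ∀ m, c ≠ m → m ∈ M2 → dec m ≠ dec c) (hdd : ∀ m, d ≠ m → m ∈ M3 → dec m ≠ dec d) :
    IsStrongEq α (PP a b c d) := by
  intro K s' hK hv hK'
  obtain ⟨a', ha, b', hb, c', hc, d', hd, rfl⟩ := exists_masks s' hv
  have hst := stable_of_good h ha hb hc hd
  obtain ⟨⟨p0, p1, p2, p3⟩, q0, q1, q2, q3⟩ := good_vals h
  have notBeq : ∀ x y : ℕ, Nat.beq x y = false → x ≠ y := fun x y => Nat.ne_of_beq_eq_false
  simp only [stable, Bool.and_eq_true, Bool.or_eq_true, Nat.beq_eq, Bool.not_eq_true'] at hst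
  rcases hst with ⟨rfl, rfl, rfl, rfl⟩ | ⟨hn, hle⟩ | ⟨hn, hle⟩ | ⟨hn, hle⟩ | ⟨hn, hle⟩
  · obtain ⟨i, hi⟩ := hK
    exact ⟨i, hi, le_rfl⟩
  · refine ⟨0, ?_, ?_⟩
    · by_contra hi
      exact hda a' (notBeq _ _ hn) ha (hK' 0 hi)
    · rw [cost0, cost0, p0, q0]; exact nb_le h1 h2 hle
  · refine ⟨1, ?_, ?_⟩
    · by_contra hi
      exact hdb b' (notBeq _ _ hn) hb (hK' 1 hi)
    · rw [cost1, cost1, p1, q1]; exact nb_le h1 h2 hle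
  · refine ⟨2, ?_, ?_⟩
    · by_contra hi
      exact hdc c' (notBeq _ _ hn) hc (hK' 2 hi)
    · rw [cost2, cost2, p2, q2]; exact nb_le h1 h2 hle
  · refine ⟨3, ?_, ?_⟩
    · by_contra hi
      exact hdd d' (notBeq _ _ hn) hd (hK' 3 hi)
    · rw [cost3, cost3, p3, q3]; exact nb_le h1 h2 hle

lemma dec_inj : ∀ m < 16, ∀ n < 16, n ≠ m → dec m ≠ dec n := by decide +kernel

lemma M0_lt : ∀ m ∈ M0, m < 16 := by decide
lemma M1_lt : ∀ m ∈ M1, m < 16 := by decide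
lemma M2_lt : ∀ m ∈ M2, m < 16 := by decide
lemma M3_lt : ∀ m ∈ M3, m < 16 := by decide

/-! ### The combinatorial description of the good profiles -/

/-- Degree as a sum of adjacencies. -/
def dg (x y z : Bool) : ℕ := x.toNat + y.toNat + z.toNat

lemma degree_eq (s : Profile 4) (i j k l : Fin 4) (hjk : j ≠ k) (hjl : j ≠ l) (hkl : k ≠ l)
    (hij : i ≠ j) (hik : i ≠ k) (hil : i ≠ l)
    (h4 : ∀ x, x = i ∨ x = j ∨ x = k ∨ x = l) :
    (NCGraph s).degree i = dg (decide ((NCGraph s).Adj i j)) (decide ((NCGraph s).Adj i k))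
      (decide ((NCGraph s).Adj i l)) := by
  have hu : (Finset.univ : Finset (Fin 4)) = {i, j, k, l} := by
    ext x; simpa using h4 x
  rw [← SimpleGraph.card_neighborFinset_eq_degree, SimpleGraph.neighborFinset_eq_filter,
    Finset.card_filter, hu, Finset.sum_insert (by simp [*]), Finset.sum_insert (by simp [*]),
    Finset.sum_insert (by simp [*]), Finset.sum_singleton]
  simp [dg, Bool.toNat, Bool.cond_eq_ite, add_assoc]

/-- Cards and degrees at the level of masks. -/
def nec (a b c d : ℕ) : Bool :=
  (Nat.beq (pc a) 1 && (Nat.beq (pc b) 1 && (Nat.beq (pc c) 1 && Nat.beq (pc d) 1))) &&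
  (Nat.beq (dg (eb a b 0 1) (eb a c 0 2) (eb a d 0 3)) 2 &&
  (Nat.beq (dg (eb a b 0 1) (eb b c 1 2) (eb b d 1 3)) 2 &&
  (Nat.beq (dg (eb a c 0 2) (eb b c 1 2) (eb c d 2 3)) 2 &&
  Nat.beq (dg (eb a d 0 3) (eb b d 1 3) (eb c d 2 3)) 2)))

lemma search3 : (M0.all fun a => M1.all fun b => M2.all fun c => M3.all fun d =>
    !(nec a b c d) || good a b c d) = true := by decide +kernel

lemma deg_PP (a b c d : ℕ) :
    (NCGraph (PP a b c d)).degree 0 = dg (eb a b 0 1) (eb a c 0 2) (eb a d 0 3) ∧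
    (NCGraph (PP a b c d)).degree 1 = dg (eb a b 0 1) (eb b c 1 2) (eb b d 1 3) ∧
    (NCGraph (PP a b c d)).degree 2 = dg (eb a c 0 2) (eb b c 1 2) (eb c d 2 3) ∧
    (NCGraph (PP a b c d)).degree 3 = dg (eb a d 0 3) (eb b d 1 3) (eb c d 2 3) := by
  have e01 := adj_PP (PP a b c d) 0 1 a b rfl rfl (by decide)
  have e02 := adj_PP (PP a b c d) 0 2 a c rfl rfl (by decide)
  have e03 := adj_PP (PP a b c d) 0 3 a d rfl rfl (by decide)
  have e12 := adj_PP (PP a b c d) 1 2 b c rfl rfl (by decide)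
  have e13 := adj_PP (PP a b c d) 1 3 b d rfl rfl (by decide)
  have e23 := adj_PP (PP a b c d) 2 3 c d rfl rfl (by decide)
  refine ⟨?_, ?_, ?_, ?_⟩
  · rw [degree_eq _ 0 1 2 3 (by decide) (by decide) (by decide) (by decide) (by decide)
      (by decide) (by decide), e01, e02, e03]
    rfl
  · rw [degree_eq _ 1 0 2 3 (by decide) (by decide) (by decide) (by decide) (by decide)
      (by decide) (by decide)]
    simp only [SimpleGraph.adj_comm _ (1 : Fin 4) 0]
    rw [e01, e12, e13]
    rfl
  · rw [degree_eq _ 2 0 1 3 (by decide) (by decide) (by decide) (by decide) (by decide)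
      (by decide) (by decide)]
    simp only [SimpleGraph.adj_comm _ (2 : Fin 4) 0, SimpleGraph.adj_comm _ (2 : Fin 4) 1]
    rw [e02, e12, e23]
    rfl
  · rw [degree_eq _ 3 0 1 2 (by decide) (by decide) (by decide) (by decide) (by decide)
      (by decide) (by decide)]
    simp only [SimpleGraph.adj_comm _ (3 : Fin 4) 0, SimpleGraph.adj_comm _ (3 : Fin 4) 1,
      SimpleGraph.adj_comm _ (3 : Fin 4) 2]
    rw [e03, e13, e23]
    rfl

lemma good_of_cond {a b c d : ℕ} (ha : a ∈ M0) (hb : b ∈ M1) (hc : c ∈ M2) (hd : d ∈ M3)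
    (hdeg : ∀ i, (NCGraph (PP a b c d)).degree i = 2) (hcard : ∀ i, (PP a b c d i).card = 1) :
    good a b c d = true := by
  have hs := search3
  simp only [List.all_eq_true] at hs
  have h := hs a ha b hb c hc d hd
  obtain ⟨g0, g1, g2, g3⟩ := deg_PP a b c d
  have n : nec a b c d = true := by
    simp only [nec, Bool.and_eq_true, Nat.beq_eq]
    rw [← g0, ← g1, ← g2, ← g3]
    simp only [← card_dec]
    exact ⟨⟨hcard 0, hcard 1, hcard 2, hcard 3⟩, hdeg 0, hdeg 1, hdeg 2, hdeg 3⟩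
  rw [n] at h
  simpa using h

lemma good_rational {a b c d : ℕ} (h : good a b c d = true) : Rational (PP a b c d) := by
  unfold Rational
  rcases good_cases h with ⟨rfl, rfl, rfl, rfl⟩ | ⟨rfl, rfl, rfl, rfl⟩ | ⟨rfl, rfl, rfl, rfl⟩ |
    ⟨rfl, rfl, rfl, rfl⟩ | ⟨rfl, rfl, rfl, rfl⟩ | ⟨rfl, rfl, rfl, rfl⟩ <;> decide +kernel

lemma good_nec {a b c d : ℕ} (h : good a b c d = true) : nec a b c d = true := by
  rcases good_cases h with ⟨rfl, rfl, rfl, rfl⟩ | ⟨rfl, rfl, rfl, rfl⟩ | ⟨rfl, rfl, rfl, rfl⟩ |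
    ⟨rfl, rfl, rfl, rfl⟩ | ⟨rfl, rfl, rfl, rfl⟩ | ⟨rfl, rfl, rfl, rfl⟩ <;> decide +kernel

lemma good_deg {a b c d : ℕ} (h : good a b c d = true) (i : Fin 4) :
    (NCGraph (PP a b c d)).degree i = 2 ∧ (PP a b c d i).card = 1 := by
  obtain ⟨g0, g1, g2, g3⟩ := deg_PP a b c d
  have n := good_nec h
  simp only [nec, Bool.and_eq_true, Nat.beq_eq] at n
  rw [← g0, ← g1, ← g2, ← g3] at n
  simp only [← card_dec] at n
  obtain ⟨⟨c0, c1, c2, c3⟩, e0, e1, e2, e3⟩ := n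
  fin_cases i
  · exact ⟨e0, c0⟩
  · exact ⟨e1, c1⟩
  · exact ⟨e2, c2⟩
  · exact ⟨e3, c3⟩

lemma good_connected {a b c d : ℕ} (h : good a b c d = true) :
    (NCGraph (PP a b c d)).Connected := by
  have h0 : ∀ j, (NCGraph (PP a b c d)).Reachable 0 j := by
    have hd : dCost (PP a b c d) 0 ≠ ⊤ := by
      have hc := cost0 1 a b c d
      obtain ⟨⟨p0, -⟩, q0, -⟩ := good_vals h
      rw [p0, q0, cv_fin 1 (by norm_num) _ _ (by norm_num), cost] at hc
      intro ht
      rw [ht, add_top] at hc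
      exact ENNReal.ofReal_ne_top hc.symm
    intro j
    have hj := (ENNReal.sum_ne_top.1 hd) j (Finset.mem_univ j)
    apply SimpleGraph.edist_ne_top_iff_reachable.1
    intro ht
    rw [ht] at hj
    simp at hj
  have : Nonempty (Fin 4) := ⟨0⟩
  exact ⟨fun u v => (h0 u).symm.trans (h0 v)⟩

/-- For `α ∈ (1,2)` and `n = 4`: strong equilibria are exactly the rational
profiles forming the `4`-cycle in which every player buys exactly one edge
(so `|s_i| = 1 = f(s,i)` for all `i`). -/
theorem stmt19 (α : ℝ) (hα1 : 1 < α) (hα2 : α < 2)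
    (s : Profile 4) (hv : Valid s) :
    IsStrongEq α s ↔
      Rational s ∧ (NCGraph s).Connected ∧ (∀ i, (NCGraph s).degree i = 2) ∧
        ∀ i, (s i).card = 1 ∧ ((NCGraph s).degree i : ℤ) - ((s i).card : ℤ) = 1 := by
  obtain ⟨a, ha, b, hb, c, hc, d, hd, rfl⟩ := exists_masks s hv
  constructor
  · intro hS
    have hg : good a b c d = true := by
      have hs := search1
      simp only [List.all_eq_true] at hs
      have h := hs a ha b hb c hc d hd
      rw [Bool.or_eq_true] at h
      rcases h with h | h
      · exact h
      · obtain ⟨a', b', c', d', hdev⟩ := hasDev_spec h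
        exact absurd hS (not_strong_of_isDev hα1 hα2 hdev)
    refine ⟨good_rational hg, good_connected hg, fun i => (good_deg hg i).1, fun i => ?_⟩
    obtain ⟨h1, h2⟩ := good_deg hg i
    exact ⟨h2, by rw [h1, h2]; norm_num⟩
  · rintro ⟨-, -, hdeg, hcard⟩
    have hg := good_of_cond ha hb hc hd hdeg (fun i => (hcard i).1)
    exact strong_of_good hα1 hα2 hg
      (fun m hne hm => dec_inj m (M0_lt m hm) a (M0_lt a ha) hne)
      (fun m hne hm => dec_inj m (M1_lt m hm) b (M1_lt b hb) hne)
      (fun m hne hm => dec_inj m (M2_lt m hm) c (M2_lt c hc) hne)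
      (fun m hne hm => dec_inj m (M3_lt m hm) d (M3_lt d hd) hne)
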